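/- Let M₁, …, Mₙ be a finite family of von Neumann algebras and let B be a C*-algebra. Suppose that for each i, every (not necessarily linear) 2-local *-homomorphism from Mᵢ into B is linear. Then every (not necessarily linear) 2-local *-homomorphism from the ℓ∞-direct sum M₁ ⊕^∞ ⋯ ⊕^∞ Mₙ into B is linear. -/

import Mathlib

set_option synthInstance.maxHeartbeats 1000000
set_option maxHeartbeats 1000000

variable {ι : Type*} [Fintype ι]
variable {H : ι → Type*} [∀ i, NormedAddCommGroup (H i)] [∀ i, InnerProductSpace ℂ (H i)]
  [∀ i, CompleteSpace (H i)]

variable {B : Type*}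
  [NonUnitalNormedRing B] [StarRing B] [CStarRing B] [NormedSpace ℂ B]
  [IsScalarTower ℂ B B] [SMulCommClass ℂ B B] [StarModule ℂ B] [CompleteSpace B]

/-- A 2-local `*`-homomorphism from a von Neumann algebra `M` into a C*-algebra `B`. -/
def IsTwoLocalStarHomVN {H₀ : Type*} [NormedAddCommGroup H₀] [InnerProductSpace ℂ H₀]
    [CompleteSpace H₀] (M : VonNeumannAlgebra H₀) (T : M.toStarSubalgebra → B) : Prop :=
  ∀ a b : M.toStarSubalgebra,
    ∃ Φ : M.toStarSubalgebra →⋆ₙₐ[ℂ] B, Φ a = T a ∧ Φ b = T b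

/-- A 2-local `*`-homomorphism from the `ℓ∞`-direct sum of the family of von Neumann
algebras `M i` into a C*-algebra `B`. -/
def IsTwoLocalStarHomPi (M : ∀ i, VonNeumannAlgebra (H i))
    (T : (∀ i, (M i).toStarSubalgebra) → B) : Prop :=
  ∀ a b : ∀ i, (M i).toStarSubalgebra,
    ∃ Φ : (∀ i, (M i).toStarSubalgebra) →⋆ₙₐ[ℂ] B, Φ a = T a ∧ Φ b = T b

/-- Any 2-local `*`-homomorphism is linear. -/
theorem twoLocal_linear_aux {A C : Type*} [NonUnitalRing A] [StarRing A] [Module ℂ A]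
    [StarModule ℂ A] [NonUnitalRing C] [StarRing C] [Module ℂ C] [StarModule ℂ C]
    (T : A → C) (hT : ∀ a b : A, ∃ Φ : A →⋆ₙₐ[ℂ] C, Φ a = T a ∧ Φ b = T b) :
    (∀ x y, T (x + y) = T x + T y) ∧ (∀ (c : ℂ) x, T (c • x) = c • T x) := by
  have L : ∀ (α β : ℂ) (x : A), T (α • x + β • star x) = α • T x + β • star (T x) := by
    intro α β x
    obtain ⟨Φ, h1, h2⟩ := hT x (α • x + β • star x)
    rw [← h2, ← h1, map_add, map_smul, map_smul, map_star]
  have hs : ∀ (c : ℂ) x, T (c • x) = c • T x := by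
    intro c x
    simpa using L c 0 x
  -- real and imaginary parts of `a + i b` for self-adjoint `a`, `b`
  have sa : ∀ a b : A, star a = a → star b = b → T (a + b) = T a + T b := by
    intro a b ha hb
    have e : star (a + Complex.I • b) = a - Complex.I • b := by
      simp [star_add, star_smul, ha, hb, sub_eq_add_neg]
    have h1 := L (1 / 2) (1 / 2) (a + Complex.I • b)
    have h2 := L (-Complex.I / 2) (Complex.I / 2) (a + Complex.I • b)
    have h3 := L ((1 - Complex.I) / 2) ((1 + Complex.I) / 2) (a + Complex.I • b)
    rw [e] at h1 h2 h3
    have e1 : (1 / 2 : ℂ) • (a + Complex.I • b) + (1 / 2 : ℂ) • (a - Complex.I • b) = a := by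
      module
    have e2 : (-Complex.I / 2) • (a + Complex.I • b)
        + (Complex.I / 2) • (a - Complex.I • b) = b := by
      have : (-Complex.I / 2) • (a + Complex.I • b) + (Complex.I / 2) • (a - Complex.I • b)
          = (-(Complex.I * Complex.I)) • b := by module
      rw [this, Complex.I_mul_I]; simp
    have e3 : ((1 - Complex.I) / 2) • (a + Complex.I • b)
        + ((1 + Complex.I) / 2) • (a - Complex.I • b) = a + b := by
      have : ((1 - Complex.I) / 2) • (a + Complex.I • b)
          + ((1 + Complex.I) / 2) • (a - Complex.I • b)
          = a + (-(Complex.I * Complex.I)) • b := by module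
      rw [this, Complex.I_mul_I]; simp
    rw [e1] at h1
    rw [e2] at h2
    rw [e3] at h3
    rw [h1, h2, h3]
    module
  have dec : ∀ x : A, ∃ a b : A, star a = a ∧ star b = b ∧ x = a + Complex.I • b := by
    intro x
    refine ⟨(1 / 2 : ℂ) • (x + star x), (-Complex.I / 2) • (x - star x), ?_, ?_, ?_⟩
    · simp [star_smul, add_comm]
    · simp only [star_smul, star_sub, star_star]
      simp
      module
    · have : (1 / 2 : ℂ) • (x + star x) + Complex.I • (-Complex.I / 2) • (x - star x)
          = (1 / 2 : ℂ) • (x + star x) + (-(Complex.I * Complex.I) / 2) • (x - star x) := by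
        module
      rw [this, Complex.I_mul_I]
      module
  have cart : ∀ a b : A, star a = a → star b = b →
      T (a + Complex.I • b) = T a + Complex.I • T b := by
    intro a b ha hb
    have e : star (a + Complex.I • b) = a - Complex.I • b := by
      simp [star_add, star_smul, ha, hb, sub_eq_add_neg]
    have h1 := L (1 / 2) (1 / 2) (a + Complex.I • b)
    have h2 := L (1 / 2) (-1 / 2) (a + Complex.I • b)
    rw [e] at h1 h2
    have e1 : (1 / 2 : ℂ) • (a + Complex.I • b) + (1 / 2 : ℂ) • (a - Complex.I • b) = a := by
      module
    have e2 : (1 / 2 : ℂ) • (a + Complex.I • b) + (-1 / 2 : ℂ) • (a - Complex.I • b)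
        = Complex.I • b := by
      module
    rw [e1] at h1
    rw [e2] at h2
    rw [← hs, h1, h2]
    module
  refine ⟨fun x y => ?_, hs⟩
  obtain ⟨a, b, ha, hb, rfl⟩ := dec x
  obtain ⟨c, d, hc, hd, rfl⟩ := dec y
  have e : a + Complex.I • b + (c + Complex.I • d) = (a + c) + Complex.I • (b + d) := by
    module
  rw [e, cart _ _ (by rw [star_add, ha, hc]) (by rw [star_add, hb, hd]), cart a b ha hb,
    cart c d hc hd, sa a c ha hc, sa b d hb hd]
  module

/-- Let `M₁, …, Mₙ` be a finite family of von Neumann algebras and `B` a C*-algebra.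
If every 2-local `*`-homomorphism from each `Mᵢ` into `B` is linear, then every 2-local
`*`-homomorphism from the `ℓ∞`-direct sum of the `Mᵢ` into `B` is linear. -/
theorem twoLocalStarHom_pi_linear (M : ∀ i, VonNeumannAlgebra (H i))
    (hM : ∀ i, ∀ S : (M i).toStarSubalgebra → B, IsTwoLocalStarHomVN (M i) S →
      (∀ x y, S (x + y) = S x + S y) ∧ (∀ (c : ℂ) x, S (c • x) = c • S x))
    (T : (∀ i, (M i).toStarSubalgebra) → B) (hT : IsTwoLocalStarHomPi M T) :
    (∀ x y, T (x + y) = T x + T y) ∧ (∀ (c : ℂ) x, T (c • x) = c • T x) := by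
  exact twoLocal_linear_aux T hT
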